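/- arXiv:1603.00783 — 9 statements merged into one kernel-verified Lean document; each statement's English description precedes it below -/
import Mathlib

section
/- Let b ∈ (0, 1). There exists a constant C_b > 0 such that for every t > 0 and every x ∈ ℝ, the Stein derivative of the function y ↦ e^{i t y³} satisfies 𝒟^b(e^{it(·)³})(x) ≤ C_b ( t^{b/3} + t^{1/3 + 2b/9} + ( t^{1/3 + 2b/3} + t^{2b/3} ) |x|^{2b} ). -/
open MeasureTheory

/-- The Stein derivative of order `b` of a function `f : ℝ → ℂ`. -/
noncomputable def steinDeriv (b : ℝ) (f : ℝ → ℂ) (x : ℝ) : ℝ :=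
  (∫ y : ℝ, ‖f x - f y‖ ^ 2 / |x - y| ^ (1 + 2 * b)) ^ ((1 : ℝ) / 2)

/-- The Stein kernel truncated at scale one is integrable. -/
lemma integrable_min_one_sq_div_abs_rpow {b : ℝ} (hb : b ∈ Set.Ioo (0 : ℝ) 1) :
    Integrable (fun u : ℝ => min 1 |u| ^ 2 / |u| ^ (1 + 2 * b)) := by
  obtain ⟨hb0, hb1⟩ := hb
  have key := integrable_fun_norm_addHaar (volume : Measure ℝ)
    (f := fun r : ℝ => min 1 r ^ 2 / r ^ (1 + 2 * b))
  simp only [Real.norm_eq_abs, Module.finrank_self, Nat.sub_self, pow_zero, one_smul] at key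
  rw [key, ← Set.Ioc_union_Ioi_eq_Ioi (zero_le_one' ℝ)]
  refine IntegrableOn.union ?_ ?_
  · have h : IntegrableOn (fun u : ℝ => u ^ (1 - 2 * b)) (Set.Ioc 0 1) :=
      (intervalIntegrable_iff_integrableOn_Ioc_of_le zero_le_one).1
        (intervalIntegral.intervalIntegrable_rpow' (by linarith))
    refine h.congr_fun (fun u hu => ?_) measurableSet_Ioc
    simp only [min_eq_right hu.2]
    rw [← Real.rpow_natCast u 2, ← Real.rpow_sub hu.1]
    congr 1
    push_cast
    ring
  · have h : IntegrableOn (fun u : ℝ => u ^ (-(1 + 2 * b))) (Set.Ioi 1) :=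
      integrableOn_Ioi_rpow_of_lt (by linarith) zero_lt_one
    refine h.congr_fun (fun u hu => ?_) measurableSet_Ioi
    have hu' : (1 : ℝ) < u := hu
    simp only [min_eq_left hu'.le]
    rw [Real.rpow_neg (by linarith), one_pow, one_div]

/-- A function oscillating at frequency at most `A` has Stein derivative of order `A ^ b`. -/
lemma steinDeriv_le_of_norm_sub_le {b : ℝ} (hb : b ∈ Set.Ioo (0 : ℝ) 1) {f : ℝ → ℂ} {x A M : ℝ}
    (hA : 0 < A) (hM : 0 ≤ M) (hf : ∀ y, ‖f x - f y‖ ≤ M * min 1 (A * |x - y|)) :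
    steinDeriv b f x ≤
      M * (∫ u : ℝ, min 1 |u| ^ 2 / |u| ^ (1 + 2 * b)) ^ ((1 : ℝ) / 2) * A ^ b := by
  set g : ℝ → ℝ := fun u => min 1 |u| ^ 2 / |u| ^ (1 + 2 * b) with hg
  have hgi : Integrable g := integrable_min_one_sq_div_abs_rpow hb
  have hK : 0 ≤ ∫ u, g u := integral_nonneg fun u => by positivity
  have hscale : ∀ y, M ^ 2 * A ^ (1 + 2 * b) * g (A * (x - y)) =
      (M * min 1 (A * |x - y|)) ^ 2 / |x - y| ^ (1 + 2 * b) := fun y => by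
    have hA' : A ^ (1 + 2 * b) ≠ 0 := (Real.rpow_pos_of_pos hA _).ne'
    simp only [hg, abs_mul, abs_of_pos hA]
    rw [Real.mul_rpow hA.le (abs_nonneg _), mul_pow, mul_div_assoc', mul_right_comm,
      mul_comm _ (A ^ (1 + 2 * b)), mul_div_mul_left _ _ hA']
  have hle : ∫ y, ‖f x - f y‖ ^ 2 / |x - y| ^ (1 + 2 * b) ≤
      ∫ y, M ^ 2 * A ^ (1 + 2 * b) * g (A * (x - y)) := by
    refine integral_mono_of_nonneg (.of_forall fun y => by positivity)
      (((hgi.comp_mul_left' hA.ne').comp_sub_left x).const_mul _) (.of_forall fun y => ?_)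
    simp only [hscale]
    gcongr
    exact hf y
  have hval : ∫ y, M ^ 2 * A ^ (1 + 2 * b) * g (A * (x - y)) =
      M ^ 2 * (∫ u, g u) * (A ^ b) ^ 2 := by
    rw [integral_const_mul, integral_sub_left_eq_self (fun y => g (A * y)) volume x,
      Measure.integral_comp_mul_left, abs_of_pos (inv_pos.2 hA), smul_eq_mul,
      Real.rpow_add hA, Real.rpow_one, mul_comm 2 b, Real.rpow_mul hA.le, Real.rpow_two]
    field_simp
  calc steinDeriv b f x
      ≤ (M ^ 2 * (∫ u, g u) * (A ^ b) ^ 2) ^ ((1 : ℝ) / 2) :=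
        Real.rpow_le_rpow (integral_nonneg fun y => by positivity) (hle.trans_eq hval) (by norm_num)
    _ = M * (∫ u, g u) ^ ((1 : ℝ) / 2) * A ^ b := by
        simp only [← Real.sqrt_eq_rpow]
        rw [Real.sqrt_mul (by positivity), Real.sqrt_mul (by positivity), Real.sqrt_sq hM,
          Real.sqrt_sq (by positivity)]

lemma norm_exp_I_mul_ofReal_sub_le (u v : ℝ) :
    ‖Complex.exp (Complex.I * (u : ℂ)) - Complex.exp (Complex.I * (v : ℂ))‖ ≤ |u - v| := by
  have h : Complex.exp (Complex.I * (u : ℂ)) - Complex.exp (Complex.I * (v : ℂ)) =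
      Complex.exp (Complex.I * (v : ℂ)) * (Complex.exp (Complex.I * ((u - v : ℝ) : ℂ)) - 1) := by
    rw [mul_sub, ← Complex.exp_add, mul_one]
    push_cast
    ring_nf
  rw [h, norm_mul, Complex.norm_exp_I_mul_ofReal, one_mul, ← Real.norm_eq_abs]
  exact Real.norm_exp_I_mul_ofReal_sub_one_le

lemma abs_mul_cube_sub_cube_le {r x y : ℝ} (hr : 0 < r)
    (hy : r * (1 + (r * x) ^ 2) * |x - y| ≤ 1) :
    |r ^ 3 * x ^ 3 - r ^ 3 * y ^ 3| ≤ 6 * (r * (1 + (r * x) ^ 2) * |x - y|) := by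
  have hd : |r * x - r * y| ≤ 1 := by
    rw [← mul_sub, abs_mul, abs_of_pos hr]
    nlinarith [mul_nonneg (mul_nonneg hr.le (sq_nonneg (r * x))) (abs_nonneg (x - y))]
  have hq : |(r * x) ^ 2 + (r * x) * (r * y) + (r * y) ^ 2| ≤ 6 * (1 + (r * x) ^ 2) := by
    obtain ⟨h1, h2⟩ := abs_le.1 hd
    rw [abs_le]
    constructor <;> nlinarith [sq_nonneg (r * x + r * y), sq_nonneg (r * x - (r * x - r * y)),
      sq_nonneg (r * x + (r * x - r * y))]
  calc |r ^ 3 * x ^ 3 - r ^ 3 * y ^ 3|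
      = r * |x - y| * |(r * x) ^ 2 + (r * x) * (r * y) + (r * y) ^ 2| := by
        rw [← abs_of_pos hr, ← abs_mul, ← abs_mul, abs_of_pos hr]
        ring_nf
    _ ≤ r * |x - y| * (6 * (1 + (r * x) ^ 2)) := by gcongr
    _ = 6 * (r * (1 + (r * x) ^ 2) * |x - y|) := by ring

lemma norm_exp_cubic_sub_le {r : ℝ} (hr : 0 < r) (x y : ℝ) :
    ‖Complex.exp (Complex.I * ((r ^ 3 * x ^ 3 : ℝ) : ℂ)) -
        Complex.exp (Complex.I * ((r ^ 3 * y ^ 3 : ℝ) : ℂ))‖ ≤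
      6 * min 1 (r * (1 + (r * x) ^ 2) * |x - y|) := by
  rcases le_total (r * (1 + (r * x) ^ 2) * |x - y|) 1 with h | h
  · rw [min_eq_right h]
    exact (norm_exp_I_mul_ofReal_sub_le _ _).trans (abs_mul_cube_sub_cube_le hr h)
  · rw [min_eq_left h]
    refine (norm_sub_le _ _).trans ?_
    rw [Complex.norm_exp_I_mul_ofReal, Complex.norm_exp_I_mul_ofReal]
    norm_num

lemma rpow_le_rpow_add_rpow {t p q s : ℝ} (ht : 0 < t) (hq : q ≤ s) (hp : s ≤ p) :
    t ^ s ≤ t ^ p + t ^ q := by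
  rcases le_total t 1 with h | h
  · linarith [Real.rpow_le_rpow_of_exponent_ge ht h hq, Real.rpow_nonneg ht.le p]
  · linarith [Real.rpow_le_rpow_of_exponent_le h hp, Real.rpow_nonneg ht.le q]

lemma rpow_frequency_le {b t : ℝ} (hb : b ∈ Set.Ioo (0 : ℝ) 1) (ht : 0 < t) (x : ℝ) :
    (t ^ ((1 : ℝ) / 3) * (1 + (t ^ ((1 : ℝ) / 3) * x) ^ 2)) ^ b ≤
      t ^ (b / 3) + t ^ b * |x| ^ (2 * b) := by
  obtain ⟨hb0, hb1⟩ := hb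
  have h1 : (t ^ ((1 : ℝ) / 3)) ^ b = t ^ (b / 3) := by
    rw [← Real.rpow_mul ht.le]
    ring_nf
  have h2 : ((t ^ ((1 : ℝ) / 3) * x) ^ 2) ^ b = t ^ (2 * b / 3) * |x| ^ (2 * b) := by
    rw [← sq_abs, abs_mul, abs_of_pos (by positivity), ← Real.rpow_two, ← Real.rpow_mul
      (by positivity), Real.mul_rpow (by positivity) (abs_nonneg x), ← Real.rpow_mul ht.le]
    ring_nf
  calc (t ^ ((1 : ℝ) / 3) * (1 + (t ^ ((1 : ℝ) / 3) * x) ^ 2)) ^ b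
      = t ^ (b / 3) * (1 + (t ^ ((1 : ℝ) / 3) * x) ^ 2) ^ b := by
        rw [Real.mul_rpow (by positivity) (by positivity), h1]
    _ ≤ t ^ (b / 3) * (1 ^ b + ((t ^ ((1 : ℝ) / 3) * x) ^ 2) ^ b) := by
        gcongr
        exact Real.rpow_add_le_add_rpow zero_le_one (sq_nonneg _) hb0.le hb1.le
    _ = t ^ (b / 3) + t ^ b * |x| ^ (2 * b) := by
        rw [Real.one_rpow, h2, mul_add, mul_one, ← mul_assoc, ← Real.rpow_add ht]
        ring_nf

theorem stein_deriv_exp_cubic_bound (b : ℝ) (hb : b ∈ Set.Ioo (0 : ℝ) 1) :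
    ∃ C : ℝ, 0 < C ∧ ∀ t : ℝ, 0 < t → ∀ x : ℝ,
      steinDeriv b (fun y : ℝ => Complex.exp (Complex.I * ((t * y ^ 3 : ℝ) : ℂ))) x ≤
        C * (t ^ (b / 3) + t ^ (1 / 3 + 2 * b / 9) +
          (t ^ (1 / 3 + 2 * b / 3) + t ^ (2 * b / 3)) * |x| ^ (2 * b)) := by
  set K := (∫ u : ℝ, min 1 |u| ^ 2 / |u| ^ (1 + 2 * b)) ^ ((1 : ℝ) / 2)
  have hK : 0 ≤ K := Real.rpow_nonneg (integral_nonneg fun u => by positivity) _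
  refine ⟨6 * K + 1, by positivity, fun t ht x => ?_⟩
  have hr : 0 < t ^ ((1 : ℝ) / 3) := Real.rpow_pos_of_pos ht _
  have hr3 : (t ^ ((1 : ℝ) / 3)) ^ 3 = t := by
    rw [← Real.rpow_natCast, ← Real.rpow_mul ht.le]
    norm_num
  have hosc := norm_exp_cubic_sub_le hr x
  rw [hr3] at hosc
  have hexp : t ^ b ≤ t ^ (1 / 3 + 2 * b / 3) + t ^ (2 * b / 3) :=
    rpow_le_rpow_add_rpow ht (by linarith [hb.1]) (by linarith [hb.2])
  calc steinDeriv b (fun y : ℝ => Complex.exp (Complex.I * ((t * y ^ 3 : ℝ) : ℂ))) x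
      ≤ 6 * K * (t ^ ((1 : ℝ) / 3) * (1 + (t ^ ((1 : ℝ) / 3) * x) ^ 2)) ^ b :=
        steinDeriv_le_of_norm_sub_le hb (by positivity) (by norm_num) hosc
    _ ≤ (6 * K + 1) * (t ^ (b / 3) + t ^ b * |x| ^ (2 * b)) := by
        gcongr
        · linarith
        · exact rpow_frequency_le hb ht x
    _ ≤ _ := by
        gcongr
        exact le_add_of_nonneg_right (by positivity)
end

section
/- Let b ∈ (0, 1/2]. There exists a constant C_b > 0 such that for every t > 0 and every x ≠ 0, the Stein derivative of the function y ↦ e^{−i t / y} satisfies 𝒟^b(e^{−it/(·)})(x) ≤ C_b t^b / |x|^{2b}. -/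
open MeasureTheory

theorem norm_exp_neg_I_mul_sub_le (p q : ℝ) :
    ‖Complex.exp (-Complex.I * (p : ℂ)) - Complex.exp (-Complex.I * (q : ℂ))‖ ≤ |p - q| := by
  have h : Complex.exp (-Complex.I * (p : ℂ)) - Complex.exp (-Complex.I * (q : ℂ)) =
      Complex.exp (Complex.I * ((-q : ℝ) : ℂ)) *
        (Complex.exp (Complex.I * ((q - p : ℝ) : ℂ)) - 1) := by
    rw [mul_sub, ← Complex.exp_add]
    push_cast
    ring_nf
  rw [h, norm_mul, Complex.norm_exp_I_mul_ofReal, one_mul, abs_sub_comm]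
  exact Real.norm_exp_I_mul_ofReal_sub_one_le

theorem norm_exp_neg_I_mul_sub_le_two (p q : ℝ) :
    ‖Complex.exp (-Complex.I * (p : ℂ)) - Complex.exp (-Complex.I * (q : ℂ))‖ ≤ 2 := by
  have h (r : ℝ) : ‖Complex.exp (-Complex.I * (r : ℂ))‖ = 1 := by
    simpa using Complex.norm_exp_I_mul_ofReal (-r)
  refine (norm_sub_le _ _).trans ?_
  rw [h, h]
  norm_num

theorem integrable_min_one_sq_div_rpow {b : ℝ} (hb0 : 0 < b) (hb1 : b < 1) :
    Integrable fun v : ℝ => min 1 (v ^ 2) / |v| ^ (1 + 2 * b) := by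
  have hmeas : Measurable fun v : ℝ => min 1 (v ^ 2) / |v| ^ (1 + 2 * b) := by fun_prop
  have hsmall : IntegrableOn (fun v : ℝ => min 1 (v ^ 2) / |v| ^ (1 + 2 * b)) (Set.Ioc 0 1) := by
    have h := (intervalIntegral.intervalIntegrable_rpow' (a := 0) (b := 1)
      (show -1 < 1 - 2 * b by linarith)).1
    refine h.mono' hmeas.aestronglyMeasurable ?_
    refine (ae_restrict_mem measurableSet_Ioc).mono fun v hv => ?_
    rw [Real.norm_of_nonneg (by positivity), abs_of_pos hv.1,
      show 1 - 2 * b = 2 - (1 + 2 * b) by ring, Real.rpow_sub hv.1, Real.rpow_two]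
    exact div_le_div_of_nonneg_right (min_le_right _ _) (Real.rpow_nonneg hv.1.le _)
  have hlarge : IntegrableOn (fun v : ℝ => min 1 (v ^ 2) / |v| ^ (1 + 2 * b)) (Set.Ioi 1) := by
    have h := integrableOn_Ioi_rpow_of_lt (show -(1 + 2 * b) < -1 by linarith) one_pos
    refine h.mono' hmeas.aestronglyMeasurable ?_
    refine (ae_restrict_mem measurableSet_Ioi).mono fun v hv => ?_
    have hv0 : 0 < v := one_pos.trans hv
    rw [Real.norm_of_nonneg (by positivity), abs_of_pos hv0, Real.rpow_neg hv0.le, ← one_div]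
    gcongr
    exact min_le_left _ _
  have hpos : IntegrableOn (fun v : ℝ => min 1 (v ^ 2) / |v| ^ (1 + 2 * b)) (Set.Ioi 0) := by
    rw [← Set.Ioc_union_Ioi_eq_Ioi zero_le_one]
    exact hsmall.union hlarge
  have hneg : IntegrableOn (fun v : ℝ => min 1 (v ^ 2) / |v| ^ (1 + 2 * b)) (Set.Iic 0) := by
    rw [integrableOn_Iic_iff_integrableOn_Iio]
    rw [← neg_zero] at hpos
    simpa using hpos.comp_neg_Iio
  rw [← integrableOn_univ, ← Set.Iic_union_Ioi (a := (0 : ℝ))]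
  exact hneg.union hpos

/-- Pointwise domination of the integrand, split at `|y| = |x| / 2`. -/
theorem norm_sq_div_rpow_le {b t x : ℝ} (hb : 0 < b) (ht : 0 < t) (hx : x ≠ 0) (y : ℝ) :
    ‖Complex.exp (-Complex.I * ((t / x : ℝ) : ℂ)) -
        Complex.exp (-Complex.I * ((t / y : ℝ) : ℂ))‖ ^ 2 / |x - y| ^ (1 + 2 * b) ≤
      4 * (min 1 ((t / x ^ 2 * (x - y)) ^ 2) / |x - y| ^ (1 + 2 * b)) +
        (2 / |x|) ^ (1 + 2 * b) * (8 * (1 + (y / min t |x|) ^ 2)⁻¹) := by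
  have hx0 : 0 < |x| := abs_pos.2 hx
  have h2 := norm_exp_neg_I_mul_sub_le_two (t / x) (t / y)
  have hθ := norm_exp_neg_I_mul_sub_le (t / x) (t / y)
  set N := ‖Complex.exp (-Complex.I * ((t / x : ℝ) : ℂ)) -
        Complex.exp (-Complex.I * ((t / y : ℝ) : ℂ))‖ with hN
  have hN0 : 0 ≤ N := norm_nonneg _
  have hθ' : y ≠ 0 → N * |y| ≤ t * |x - y| / |x| := by
    intro hy
    have hy0 : 0 < |y| := abs_pos.2 hy
    have : |t / x - t / y| = t * |x - y| / |x| / |y| := by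
      rw [div_sub_div _ _ hx hy, mul_comm x t, ← mul_sub, abs_div, abs_mul, abs_mul, abs_of_pos ht,
        abs_sub_comm, div_div]
    rw [this, le_div_iff₀ hy0] at hθ
    exact hθ
  rcases le_or_gt (|x| / 2) |y| with hy | hy
  · have hy0 : 0 < |y| := by linarith
    have hN2 : N ≤ 2 * (t / x ^ 2 * |x - y|) := by
      have h := hθ' (abs_pos.1 hy0)
      have h' : N * (|x| / 2) ≤ t * |x - y| / |x| := (by gcongr : _ ≤ N * |y|).trans h
      rw [← sq_abs x]
      calc N = N * (|x| / 2) * (2 / |x|) := by field_simp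
        _ ≤ t * |x - y| / |x| * (2 / |x|) := by gcongr
        _ = _ := by field_simp
    have hmain : N ^ 2 ≤ 4 * min 1 ((t / x ^ 2 * (x - y)) ^ 2) := by
      rw [mul_min_of_nonneg _ _ (by norm_num), le_min_iff]
      constructor
      · nlinarith
      · calc N ^ 2 ≤ (2 * (t / x ^ 2 * |x - y|)) ^ 2 := by gcongr
          _ = _ := by rw [mul_pow, mul_pow, mul_pow, sq_abs]; norm_num
    refine le_add_of_le_of_nonneg ?_ (by positivity)
    rw [← mul_div_assoc]
    gcongr
  · refine le_add_of_nonneg_of_le (by positivity) ?_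
    have hd : |x| / 2 ≤ |x - y| := by
      have := abs_sub_abs_le_abs_sub x y
      linarith
    have hd' : |x - y| ≤ 3 / 2 * |x| := by
      have := abs_sub x y
      linarith
    have hNt : N * |y| ≤ 3 / 2 * t := by
      rcases eq_or_ne y 0 with rfl | hy0
      · simp; positivity
      · refine (hθ' hy0).trans ?_
        rw [div_le_iff₀ hx0]
        nlinarith
    have hNx : N * |y| ≤ 3 / 2 * |x| := by nlinarith [abs_nonneg y]
    have hm0 : 0 < min t |x| := lt_min ht hx0
    have hNm : N * |y| ≤ 3 / 2 * min t |x| := by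
      rw [mul_min_of_nonneg _ _ (by norm_num)]
      exact le_min hNt hNx
    have hsq : N ^ 2 ≤ 8 * (1 + (y / min t |x|) ^ 2)⁻¹ := by
      rw [← div_eq_mul_inv, le_div_iff₀ (by positivity)]
      have : (N * (|y| / min t |x|)) ^ 2 ≤ (3 / 2) ^ 2 := by
        gcongr
        rw [← mul_div_assoc, div_le_iff₀ hm0]
        exact hNm
      rw [mul_pow, div_pow, sq_abs, ← div_pow] at this
      nlinarith
    calc N ^ 2 / |x - y| ^ (1 + 2 * b) ≤ N ^ 2 / (|x| / 2) ^ (1 + 2 * b) := by gcongr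
      _ = (2 / |x|) ^ (1 + 2 * b) * N ^ 2 := by
        rw [← inv_div |x| 2, Real.inv_rpow (by positivity), div_eq_inv_mul]
      _ ≤ _ := by gcongr

theorem min_sq_div_rpow_eq {b A : ℝ} (hA : 0 < A) (v : ℝ) :
    min 1 ((A * v) ^ 2) / |v| ^ (1 + 2 * b) =
      A ^ (1 + 2 * b) * (min 1 ((A * v) ^ 2) / |A * v| ^ (1 + 2 * b)) := by
  rw [abs_mul, abs_of_pos hA, Real.mul_rpow hA.le (abs_nonneg v)]
  have := (Real.rpow_pos_of_pos hA (1 + 2 * b)).ne'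
  field_simp

theorem integral_min_sq_div_rpow {b A : ℝ} (hA : 0 < A) (x : ℝ) :
    ∫ y : ℝ, min 1 ((A * (x - y)) ^ 2) / |x - y| ^ (1 + 2 * b) =
      A ^ (2 * b) * ∫ v : ℝ, min 1 (v ^ 2) / |v| ^ (1 + 2 * b) := by
  rw [integral_sub_left_eq_self (fun v : ℝ => min 1 ((A * v) ^ 2) / |v| ^ (1 + 2 * b)) volume x]
  simp_rw [min_sq_div_rpow_eq hA]
  rw [integral_const_mul, Measure.integral_comp_mul_left
    (fun v : ℝ => min 1 (v ^ 2) / |v| ^ (1 + 2 * b)), abs_of_pos (inv_pos.2 hA), smul_eq_mul,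
    Real.rpow_add hA, Real.rpow_one]
  field_simp

theorem integrable_min_sq_div_rpow {b A : ℝ} (hb0 : 0 < b) (hb1 : b < 1) (hA : 0 < A) (x : ℝ) :
    Integrable fun y : ℝ => min 1 ((A * (x - y)) ^ 2) / |x - y| ^ (1 + 2 * b) := by
  simp_rw [min_sq_div_rpow_eq hA]
  exact (((integrable_min_one_sq_div_rpow hb0 hb1).comp_mul_left' hA.ne').const_mul
    _).comp_sub_left x

theorem integral_norm_sq_div_rpow_le {b t x : ℝ} (hb0 : 0 < b) (hb1 : b ≤ 1 / 2) (ht : 0 < t)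
    (hx : x ≠ 0) :
    ∫ y : ℝ, ‖Complex.exp (-Complex.I * ((t / x : ℝ) : ℂ)) -
        Complex.exp (-Complex.I * ((t / y : ℝ) : ℂ))‖ ^ 2 / |x - y| ^ (1 + 2 * b) ≤
      (4 * (∫ v : ℝ, min 1 (v ^ 2) / |v| ^ (1 + 2 * b)) + 2 ^ (1 + 2 * b) * (8 * Real.pi)) *
        (t ^ b / |x| ^ (2 * b)) ^ 2 := by
  have hx0 : 0 < |x| := abs_pos.2 hx
  have hm0 : 0 < min t |x| := lt_min ht hx0
  have hA : 0 < t / x ^ 2 := by positivity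
  have hint₁ := (integrable_min_sq_div_rpow hb0 (by linarith) hA x).const_mul 4
  have hint₂ := ((integrable_inv_one_add_sq.comp_div hm0.ne').const_mul 8).const_mul
    ((2 / |x|) ^ (1 + 2 * b))
  have hmin : min t |x| ≤ t ^ (2 * b) * |x| ^ (1 - 2 * b) := by
    calc min t |x| = min t |x| ^ (2 * b) * min t |x| ^ (1 - 2 * b) := by
          rw [← Real.rpow_add hm0]; simp
      _ ≤ t ^ (2 * b) * |x| ^ (1 - 2 * b) := by
          have h : 0 ≤ 1 - 2 * b := by linarith
          gcongr
          exacts [min_le_left _ _, min_le_right _ _]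
  have hsq : (t ^ b / |x| ^ (2 * b)) ^ 2 = t ^ (2 * b) / |x| ^ (4 * b) := by
    rw [div_pow, ← Real.rpow_mul_natCast ht.le, ← Real.rpow_mul_natCast hx0.le]
    norm_num
    ring_nf
  have hnear : (t / x ^ 2) ^ (2 * b) = t ^ (2 * b) / |x| ^ (4 * b) := by
    rw [← sq_abs x, Real.div_rpow ht.le (by positivity), ← Real.rpow_natCast_mul hx0.le]
    norm_num
    ring_nf
  have hfar : (2 / |x|) ^ (1 + 2 * b) * (t ^ (2 * b) * |x| ^ (1 - 2 * b)) =
      2 ^ (1 + 2 * b) * (t ^ (2 * b) / |x| ^ (4 * b)) := by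
    have h : |x| ^ (1 + 2 * b) = |x| ^ (1 - 2 * b) * |x| ^ (4 * b) := by
      rw [← Real.rpow_add hx0]; ring_nf
    have h' := (Real.rpow_pos_of_pos hx0 (1 - 2 * b)).ne'
    have h'' := (Real.rpow_pos_of_pos hx0 (4 * b)).ne'
    rw [Real.div_rpow zero_le_two hx0.le, h]
    field_simp
  calc _ ≤ ∫ y : ℝ, (4 * (min 1 ((t / x ^ 2 * (x - y)) ^ 2) / |x - y| ^ (1 + 2 * b)) +
        (2 / |x|) ^ (1 + 2 * b) * (8 * (1 + (y / min t |x|) ^ 2)⁻¹)) :=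
        integral_mono_of_nonneg (.of_forall fun y => by positivity) (hint₁.add hint₂)
          (.of_forall (norm_sq_div_rpow_le hb0 ht hx))
    _ = 4 * ((t / x ^ 2) ^ (2 * b) * ∫ v : ℝ, min 1 (v ^ 2) / |v| ^ (1 + 2 * b)) +
        (2 / |x|) ^ (1 + 2 * b) * (8 * (min t |x| * Real.pi)) := by
        rw [integral_add hint₁ hint₂, integral_const_mul, integral_const_mul, integral_const_mul,
          integral_min_sq_div_rpow hA,
          Measure.integral_comp_div (fun y : ℝ => (1 + y ^ 2)⁻¹), integral_univ_inv_one_add_sq,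
          abs_of_pos hm0, smul_eq_mul]
    _ ≤ 4 * ((t / x ^ 2) ^ (2 * b) * ∫ v : ℝ, min 1 (v ^ 2) / |v| ^ (1 + 2 * b)) +
        (2 / |x|) ^ (1 + 2 * b) * (8 * (t ^ (2 * b) * |x| ^ (1 - 2 * b) * Real.pi)) := by
        gcongr
    _ = _ := by
        rw [hsq, hnear]
        linear_combination 8 * Real.pi * hfar

theorem stein_deriv_exp_neg_inv_bound (b : ℝ) (hb : b ∈ Set.Ioc (0 : ℝ) (1 / 2)) :
    ∃ C : ℝ, 0 < C ∧ ∀ t : ℝ, 0 < t → ∀ x : ℝ, x ≠ 0 →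
      steinDeriv b (fun y : ℝ => Complex.exp (-Complex.I * ((t / y : ℝ) : ℂ))) x ≤
        C * t ^ b / |x| ^ (2 * b) := by
  have hJ : 0 ≤ ∫ v : ℝ, min 1 (v ^ 2) / |v| ^ (1 + 2 * b) :=
    integral_nonneg fun v => by positivity
  refine ⟨√(4 * (∫ v : ℝ, min 1 (v ^ 2) / |v| ^ (1 + 2 * b)) + 2 ^ (1 + 2 * b) * (8 * Real.pi)),
    by positivity, fun t ht x hx => ?_⟩
  rw [steinDeriv, ← Real.sqrt_eq_rpow, mul_div_assoc]
  refine (Real.sqrt_le_sqrt (integral_norm_sq_div_rpow_le hb.1 hb.2 ht hx)).trans_eq ?_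
  rw [Real.sqrt_mul (by positivity), Real.sqrt_sq (by positivity)]
end

section
/- Let b ∈ (0, 1). There exists a constant C_b > 0 such that for every t > 0 and every x ≠ 0 with t^{1/3}|x| ≤ t^{−1/3} x^{−2} (equivalently |x|³ t^{2/3} ≤ 1), one has ( ∫_{{w : |w| < t^{1/3}|x|}} |e^{i(−3x²t^{2/3}w + 3x t^{1/3} w² − w³)} − 1|² / |w|^{1+2b} dw )^{1/2} ≤ C_b |x|^{3−b} t^{1−b/3} ≤ C_b t^{1/3 − b/9}. -/
open MeasureTheory

/-- The phase `−3x²t^{2/3}w + 3xt^{1/3}w² − w³` arising from the change of variables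
`w = t^{1/3}(x − y)` in the Stein derivative of `y ↦ e^{ity³}`. -/
noncomputable def cubicPhase (t x w : ℝ) : ℝ :=
  -3 * x ^ 2 * t ^ ((2 : ℝ) / 3) * w + 3 * x * t ^ ((1 : ℝ) / 3) * w ^ 2 - w ^ 3

/-- The integral of `|w| ^ r` over a symmetric interval. -/
theorem integral_abs_rpow_symm {r R : ℝ} (hr : -1 < r) (hR : 0 ≤ R) :
    ∫ w in {w : ℝ | |w| < R}, |w| ^ r = 2 * (R ^ (r + 1) / (r + 1)) := by
  have hm : MeasurableSet {w : ℝ | |w| < R} := measurableSet_lt (by fun_prop) (by fun_prop)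
  have h : ∀ w : ℝ, {w : ℝ | |w| < R}.indicator (fun w ↦ |w| ^ r) w =
      (Set.Iio R).indicator (fun w ↦ w ^ r) |w| := fun w ↦ by
    simp [Set.indicator_apply]
  rw [← integral_indicator hm, integral_congr_ae (.of_forall h), integral_comp_abs,
    setIntegral_indicator measurableSet_Iio, Set.Ioi_inter_Iio, ← integral_Ioc_eq_integral_Ioo,
    ← intervalIntegral.integral_of_le hR, integral_rpow (.inl hr),
    Real.zero_rpow (by linarith), sub_zero]

theorem integrableOn_abs_rpow_symm {r R : ℝ} (hr : -1 < r) (hR : 0 < R) :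
    IntegrableOn (fun w : ℝ ↦ |w| ^ r) {w : ℝ | |w| < R} := by
  apply Integrable.of_integral_ne_zero
  rw [integral_abs_rpow_symm hr hR.le]
  have : 0 < r + 1 := by linarith
  positivity

theorem abs_cubicPhase_le {t x w : ℝ} (ht : 0 < t) (hw : |w| ≤ t ^ ((1 : ℝ) / 3) * |x|) :
    |cubicPhase t x w| ≤ 7 * (t ^ ((1 : ℝ) / 3) * |x|) ^ 2 * |w| := by
  have hsq : t ^ ((2 : ℝ) / 3) = (t ^ ((1 : ℝ) / 3)) ^ 2 := by
    rw [← Real.rpow_mul_natCast ht.le]; norm_num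
  have hs : 0 ≤ t ^ ((1 : ℝ) / 3) := by positivity
  unfold cubicPhase
  rw [hsq]
  generalize t ^ ((1 : ℝ) / 3) = s at *
  have h1 : -3 * x ^ 2 * s ^ 2 * w + 3 * x * s * w ^ 2 - w ^ 3 =
      w * (-3 * (s * x) ^ 2 + 3 * (s * x) * w - w ^ 2) := by ring
  have hsx : s * |x| = |s * x| := by rw [abs_mul, abs_of_nonneg hs]
  rw [hsx] at hw ⊢
  rw [h1, abs_mul, mul_comm]
  refine mul_le_mul_of_nonneg_right ?_ (abs_nonneg w)
  have h2 : |w| * |w| ≤ |s * x| * |s * x| := by gcongr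
  have h3 : |s * x * w| ≤ |s * x| * |s * x| := by rw [abs_mul]; gcongr
  rw [abs_mul_abs_self] at h2 h3
  rw [abs_mul_abs_self] at h2
  rw [abs_le] at h3
  rw [sq_abs, abs_le]
  constructor <;> nlinarith [sq_nonneg w, sq_nonneg (s * x)]

theorem norm_exp_cubicPhase_sub_one_sq_div_le {b t x w : ℝ} (ht : 0 < t)
    (hw : |w| ≤ t ^ ((1 : ℝ) / 3) * |x|) :
    ‖Complex.exp (Complex.I * ((cubicPhase t x w : ℝ) : ℂ)) - 1‖ ^ 2 / |w| ^ (1 + 2 * b) ≤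
      49 * (t ^ ((1 : ℝ) / 3) * |x|) ^ 4 * |w| ^ (1 - 2 * b) := by
  rcases eq_or_ne w 0 with rfl | hw0
  · have : ‖Complex.exp (Complex.I * ((cubicPhase t x 0 : ℝ) : ℂ)) - 1‖ = 0 := by
      simp [cubicPhase]
    rw [this, zero_pow two_ne_zero, zero_div]
    positivity
  have hpos : 0 < |w| := abs_pos.mpr hw0
  have hexp : |w| ^ (1 - 2 * b) * |w| ^ (1 + 2 * b) = |w| ^ 2 := by
    rw [← Real.rpow_add hpos, ← Real.rpow_natCast]; norm_num
  rw [div_le_iff₀ (by positivity), mul_assoc, hexp]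
  calc _ ≤ (7 * (t ^ ((1 : ℝ) / 3) * |x|) ^ 2 * |w|) ^ 2 := by
        gcongr
        exact (Real.norm_exp_I_mul_ofReal_sub_one_le).trans (abs_cubicPhase_le ht hw)
    _ = _ := by ring

theorem cubic_phase_integral_small_w_case1 (b : ℝ) (hb : b ∈ Set.Ioo (0 : ℝ) 1) :
    ∃ C : ℝ, 0 < C ∧ ∀ t : ℝ, 0 < t → ∀ x : ℝ, x ≠ 0 →
      t ^ ((1 : ℝ) / 3) * |x| ≤ t ^ (-(1 : ℝ) / 3) / x ^ 2 →
      ((∫ w in {w : ℝ | |w| < t ^ ((1 : ℝ) / 3) * |x|},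
          ‖Complex.exp (Complex.I * ((cubicPhase t x w : ℝ) : ℂ)) - 1‖ ^ 2 /
            |w| ^ (1 + 2 * b)) ^ ((1 : ℝ) / 2) ≤ C * |x| ^ (3 - b) * t ^ (1 - b / 3) ∧
        C * |x| ^ (3 - b) * t ^ (1 - b / 3) ≤ C * t ^ (1 / 3 - b / 9)) := by
  obtain ⟨hb0, hb1⟩ := hb
  have hb' : 0 < 1 - b := by linarith
  refine ⟨(49 / (1 - b)) ^ ((1 : ℝ) / 2), by positivity, fun t ht x hx hxt ↦ ?_⟩
  have hx' : 0 < |x| := abs_pos.mpr hx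
  constructor
  · have hR : 0 < t ^ ((1 : ℝ) / 3) * |x| := by positivity
    have hR_pow : |x| ^ (3 - b) * t ^ (1 - b / 3) = (t ^ ((1 : ℝ) / 3) * |x|) ^ (3 - b) := by
      rw [Real.mul_rpow (by positivity) hx'.le, ← Real.rpow_mul ht.le, mul_comm]
      ring_nf
    rw [mul_assoc, hR_pow]
    have hm : MeasurableSet {w : ℝ | |w| < t ^ ((1 : ℝ) / 3) * |x|} :=
      measurableSet_lt (by fun_prop) (by fun_prop)
    have hr : -1 < 1 - 2 * b := by linarith
    have hint := integral_mono_of_nonneg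
      (μ := volume.restrict {w : ℝ | |w| < t ^ ((1 : ℝ) / 3) * |x|})
      (f := fun w ↦ ‖Complex.exp (Complex.I * ((cubicPhase t x w : ℝ) : ℂ)) - 1‖ ^ 2 /
        |w| ^ (1 + 2 * b))
      (.of_forall fun w ↦ by positivity)
      ((integrableOn_abs_rpow_symm hr hR).const_mul (49 * (t ^ ((1 : ℝ) / 3) * |x|) ^ 4))
      (ae_restrict_of_forall_mem hm fun w hw ↦
        norm_exp_cubicPhase_sub_one_sq_div_le ht (le_of_lt hw))
    rw [integral_const_mul, integral_abs_rpow_symm hr hR.le] at hint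
    generalize t ^ ((1 : ℝ) / 3) * |x| = R at *
    have hvalue : 49 * R ^ 4 * (2 * (R ^ (1 - 2 * b + 1) / (1 - 2 * b + 1))) =
        49 / (1 - b) * (R ^ (3 - b)) ^ 2 := by
      have hpow : R ^ 4 * R ^ (1 - 2 * b + 1) = (R ^ (3 - b)) ^ 2 := by
        rw [← Real.rpow_natCast, ← Real.rpow_natCast, ← Real.rpow_add hR, ← Real.rpow_mul hR.le]
        congr 1
        push_cast
        ring
      rw [← hpow, show 1 - 2 * b + 1 = 2 * (1 - b) by ring]
      field_simp
    rw [hvalue] at hint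
    calc _ ≤ (49 / (1 - b) * (R ^ (3 - b)) ^ 2) ^ ((1 : ℝ) / 2) :=
          Real.rpow_le_rpow (integral_nonneg fun w ↦ by positivity) hint (by norm_num)
      _ = _ := by
          rw [Real.mul_rpow (by positivity) (by positivity), ← Real.sqrt_eq_rpow (_ ^ 2),
            Real.sqrt_sq (by positivity)]
  · rw [mul_assoc]
    refine mul_le_mul_of_nonneg_left ?_ (by positivity)
    have hcube : |x| ^ 3 ≤ t ^ (-(2 : ℝ) / 3) := by
      rw [le_div_iff₀ (by positivity), ← sq_abs] at hxt
      have h : t ^ (-(2 : ℝ) / 3) * t ^ ((1 : ℝ) / 3) = t ^ (-(1 : ℝ) / 3) := by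
        rw [← Real.rpow_add ht]; norm_num
      rw [← h] at hxt
      refine le_of_mul_le_mul_right ?_ (Real.rpow_pos_of_pos ht ((1 : ℝ) / 3))
      linarith
    have hx_pow : |x| ^ (3 - b) = (|x| ^ 3) ^ (1 - b / 3) := by
      rw [← Real.rpow_natCast_mul hx'.le]
      congr 1
      push_cast
      ring
    calc |x| ^ (3 - b) * t ^ (1 - b / 3)
        ≤ (t ^ (-(2 : ℝ) / 3)) ^ (1 - b / 3) * t ^ (1 - b / 3) := by
          rw [hx_pow]
          gcongr
          linarith
      _ = t ^ (1 / 3 - b / 9) := by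
          rw [← Real.rpow_mul ht.le, ← Real.rpow_add ht]
          ring_nf
end

section
/- Let b ∈ (0, 1). There exists a constant C_b > 0 such that for every t > 0 and every x ≠ 0, one has ( ∫_{{w : |w| > (t^{1/3} x²)^{−1}}} |e^{i(−3x²t^{2/3}w + 3x t^{1/3} w² − w³)} − 1|² / |w|^{1+2b} dw )^{1/2} ≤ C_b t^{b/3} |x|^{2b}. -/
open MeasureTheory

theorem setIntegral_abs_rpow_of_lt {a R : ℝ} (ha : a < -1) (hR : 0 < R) :
    ∫ w in {w : ℝ | R < |w|}, |w| ^ a = 2 * (-R ^ (a + 1) / (a + 1)) := by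
  have hs : MeasurableSet {w : ℝ | R < |w|} :=
    measurableSet_lt measurable_const measurable_norm
  have hind : ({w : ℝ | R < |w|}.indicator fun w => |w| ^ a) =
      fun w => (Set.Ioi R).indicator (fun u => u ^ a) |w| := by
    ext w
    simp [Set.indicator_apply]
  rw [← integral_indicator hs, hind,
    integral_comp_abs (f := (Set.Ioi R).indicator fun u => u ^ a),
    setIntegral_indicator measurableSet_Ioi, Set.Ioi_inter_Ioi, sup_eq_right.2 hR.le,
    integral_Ioi_rpow_of_lt ha hR]

theorem integrableOn_abs_rpow_of_lt {a R : ℝ} (ha : a < -1) (hR : 0 < R) :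
    IntegrableOn (fun w : ℝ => |w| ^ a) {w : ℝ | R < |w|} := by
  refine not_imp_comm.1 integral_undef ?_
  rw [setIntegral_abs_rpow_of_lt ha hR]
  have : a + 1 ≠ 0 := by linarith
  have := (Real.rpow_pos_of_pos hR (a + 1)).ne'
  simp [*]

theorem norm_exp_I_mul_ofReal_sub_one_sq_le (θ : ℝ) :
    ‖Complex.exp (Complex.I * (θ : ℂ)) - 1‖ ^ 2 ≤ 4 := by
  have h : ‖Complex.exp (Complex.I * (θ : ℂ)) - 1‖ ≤ 2 := by
    refine (norm_sub_le _ _).trans ?_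
    rw [mul_comm, Complex.norm_exp_ofReal_mul_I, norm_one]
    norm_num
  nlinarith [norm_nonneg (Complex.exp (Complex.I * (θ : ℂ)) - 1)]

theorem setIntegral_norm_exp_sub_one_sq_div_le {b R : ℝ} (hb : 0 < b) (hR : 0 < R) (φ : ℝ → ℝ) :
    ∫ w in {w : ℝ | R < |w|},
      ‖Complex.exp (Complex.I * ((φ w : ℝ) : ℂ)) - 1‖ ^ 2 / |w| ^ (1 + 2 * b) ≤
      4 / b * R ^ (-(2 * b)) := by
  have ha : -(1 + 2 * b) < -1 := by linarith
  calc _ ≤ ∫ w in {w : ℝ | R < |w|}, 4 * |w| ^ (-(1 + 2 * b)) := by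
        refine integral_mono_of_nonneg (ae_of_all _ fun w => by positivity)
          ((integrableOn_abs_rpow_of_lt ha hR).const_mul 4) (ae_of_all _ fun w => ?_)
        dsimp only
        rw [Real.rpow_neg (abs_nonneg w), ← div_eq_mul_inv]
        gcongr
        exact norm_exp_I_mul_ofReal_sub_one_sq_le _
    _ = 4 / b * R ^ (-(2 * b)) := by
        rw [integral_const_mul, setIntegral_abs_rpow_of_lt ha hR,
          show -(1 + 2 * b) + 1 = -(2 * b) by ring]
        field_simp

theorem cubic_phase_integral_large_w (b : ℝ) (hb : b ∈ Set.Ioo (0 : ℝ) 1) :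
    ∃ C : ℝ, 0 < C ∧ ∀ t : ℝ, 0 < t → ∀ x : ℝ, x ≠ 0 →
      (∫ w in {w : ℝ | (t ^ ((1 : ℝ) / 3) * x ^ 2)⁻¹ < |w|},
          ‖Complex.exp (Complex.I * ((cubicPhase t x w : ℝ) : ℂ)) - 1‖ ^ 2 /
            |w| ^ (1 + 2 * b)) ^ ((1 : ℝ) / 2) ≤ C * t ^ (b / 3) * |x| ^ (2 * b) := by
  have hb0 : 0 < b := hb.1
  refine ⟨(4 / b) ^ ((1 : ℝ) / 2), by positivity, fun t ht x hx => ?_⟩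
  have hS : 0 < t ^ ((1 : ℝ) / 3) * x ^ 2 := by positivity
  refine (Real.rpow_le_rpow (integral_nonneg fun w => by positivity)
    (setIntegral_norm_exp_sub_one_sq_div_le hb0 (inv_pos.2 hS) (cubicPhase t x))
    (by norm_num)).trans_eq ?_
  rw [Real.rpow_neg (inv_pos.2 hS).le, Real.inv_rpow hS.le, inv_inv,
    Real.mul_rpow (by positivity) (by positivity), ← Real.rpow_mul hS.le,
    show 2 * b * (1 / 2) = b by ring, Real.mul_rpow (by positivity) (by positivity),
    ← Real.rpow_mul ht.le, ← sq_abs x, ← Real.rpow_natCast, ← Real.rpow_mul (abs_nonneg x),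
    show 1 / 3 * b = b / 3 by ring, mul_assoc]
  norm_num
end

section
/- Let b ∈ (0, 1/2]. There exists a constant C_b > 0 such that for every x > 0 and every t with 0 < t/x ≤ 6π, setting f(w) := (t/x) · w/(w − x), one has ( ∫_{{w : |w| ≤ x/2}} |e^{i f(w)} − 1|² / |w|^{1+2b} dw )^{1/2} ≤ C_b t^b / x^{2b}. -/
open MeasureTheory

/-- The phase `f(w) = (t/x) · w/(w − x)` arising from the change of variables `w = x − y`
in the Stein derivative of `y ↦ e^{−it/y}`. -/
noncomputable def mobiusPhase (t x w : ℝ) : ℝ := t / x * (w / (w - x))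

/-- The phase is at most `2 (t/x) |w| / x` in size on `|w| ≤ x / 2`. -/
lemma abs_mobiusPhase_le {t x w : ℝ} (hx : 0 < x) (hs : 0 < t / x) (hw : |w| ≤ x / 2) :
    |mobiusPhase t x w| ≤ 2 * (t / x) * (|w| / x) := by
  have hd : x / 2 ≤ |w - x| := by
    rw [abs_sub_comm]
    exact le_trans (by linarith [le_abs_self w]) (le_abs_self (x - w))
  calc |mobiusPhase t x w| = t / x * (|w| / |w - x|) := by
        rw [mobiusPhase, abs_mul, abs_div w, abs_of_pos hs]
    _ ≤ t / x * (|w| / (x / 2)) := by gcongr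
    _ = 2 * (t / x) * (|w| / x) := by field_simp

/-- For `p ≤ 2`, the function `r ↦ r ^ 2 / r ^ p` is monotone on `[0, ∞)`. -/
lemma sq_div_rpow_le_sq_div_rpow {r x p : ℝ} (hr : 0 ≤ r) (hrx : r ≤ x) (hp : p ≤ 2) :
    r ^ 2 / r ^ p ≤ x ^ 2 / x ^ p := by
  rcases hr.eq_or_lt with rfl | hr
  · simp only [ne_eq, OfNat.ofNat_ne_zero, not_false_eq_true, zero_pow, zero_div]
    positivity
  · have hx := hr.trans_le hrx
    rw [← Real.rpow_natCast, ← Real.rpow_natCast, ← Real.rpow_sub hr, ← Real.rpow_sub hx]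
    exact Real.rpow_le_rpow hr.le hrx (by push_cast; linarith)

/-- Uniform bound for the integrand on `|w| ≤ x / 2`. -/
lemma mobiusPhase_integrand_le {b t x w : ℝ} (hb : b ≤ 1 / 2) (hx : 0 < x) (hs : 0 < t / x)
    (hw : |w| ≤ x / 2) :
    ‖Complex.exp (Complex.I * ((mobiusPhase t x w : ℝ) : ℂ)) - 1‖ ^ 2 / |w| ^ (1 + 2 * b) ≤
      4 * (t / x) ^ 2 / x ^ (1 + 2 * b) := by
  have hexp : ‖Complex.exp (Complex.I * ((mobiusPhase t x w : ℝ) : ℂ)) - 1‖ ≤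
      2 * (t / x) * (|w| / x) :=
    Real.norm_exp_I_mul_ofReal_sub_one_le.trans (abs_mobiusPhase_le hx hs hw)
  calc _ ≤ (2 * (t / x) * (|w| / x)) ^ 2 / |w| ^ (1 + 2 * b) := by gcongr
    _ = 4 * (t / x) ^ 2 / x ^ 2 * (|w| ^ 2 / |w| ^ (1 + 2 * b)) := by ring
    _ ≤ 4 * (t / x) ^ 2 / x ^ 2 * (x ^ 2 / x ^ (1 + 2 * b)) := by
        gcongr ?_ * ?_
        exact sq_div_rpow_le_sq_div_rpow (abs_nonneg w) (by linarith) (by linarith)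
    _ = 4 * (t / x) ^ 2 / x ^ (1 + 2 * b) := by field_simp

theorem mobius_phase_integral_E1 (b : ℝ) (hb : b ∈ Set.Ioc (0 : ℝ) (1 / 2)) :
    ∃ C : ℝ, 0 < C ∧ ∀ x : ℝ, 0 < x → ∀ t : ℝ, 0 < t / x → t / x ≤ 6 * Real.pi →
      (∫ w in {w : ℝ | |w| ≤ x / 2},
          ‖Complex.exp (Complex.I * ((mobiusPhase t x w : ℝ) : ℂ)) - 1‖ ^ 2 /
            |w| ^ (1 + 2 * b)) ^ ((1 : ℝ) / 2) ≤ C * t ^ b / x ^ (2 * b) := by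
  refine ⟨2 * (6 * Real.pi) ^ (1 - b), by positivity, fun x hx t hs hsπ => ?_⟩
  have ht : 0 < t := (div_pos_iff_of_pos_right hx).1 hs
  have hset : {w : ℝ | |w| ≤ x / 2} = Set.Icc (-(x / 2)) (x / 2) := by
    ext w
    simp [abs_le]
  have hvol : volume.real {w : ℝ | |w| ≤ x / 2} = x := by
    rw [hset, Real.volume_real_Icc_of_le (by linarith)]
    ring
  have hint : (∫ w in {w : ℝ | |w| ≤ x / 2},
      ‖Complex.exp (Complex.I * ((mobiusPhase t x w : ℝ) : ℂ)) - 1‖ ^ 2 / |w| ^ (1 + 2 * b)) ≤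
      4 * (t / x) ^ 2 / x ^ (1 + 2 * b) * x := by
    refine (Real.le_norm_self _).trans ?_
    refine (norm_setIntegral_le_of_norm_le_const (C := 4 * (t / x) ^ 2 / x ^ (1 + 2 * b)) ?_
      fun w hw => ?_).trans_eq (by rw [hvol])
    · rw [hset]
      exact measure_Icc_lt_top
    · rw [Real.norm_of_nonneg (by positivity)]
      exact mobiusPhase_integrand_le hb.2 hx hs hw
  have hsq : 4 * (t / x) ^ 2 / x ^ (1 + 2 * b) * x = (2 * (t / x) / x ^ b) ^ 2 := by
    rw [Real.rpow_add hx, Real.rpow_one, two_mul b, Real.rpow_add hx]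
    field_simp
    norm_num
  rw [← Real.sqrt_eq_rpow]
  calc _ ≤ 2 * (t / x) / x ^ b :=
        (Real.sqrt_le_sqrt (hint.trans_eq hsq)).trans_eq (Real.sqrt_sq (by positivity))
    _ = 2 * ((t / x) ^ (1 - b) * (t / x) ^ b) / x ^ b := by
        rw [← Real.rpow_add hs, sub_add_cancel, Real.rpow_one]
    _ ≤ 2 * ((6 * Real.pi) ^ (1 - b) * (t / x) ^ b) / x ^ b := by
        have h : 0 ≤ 1 - b := by linarith [hb.2]
        gcongr
    _ = 2 * (6 * Real.pi) ^ (1 - b) * t ^ b / x ^ (2 * b) := by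
        rw [Real.div_rpow ht.le hx.le, two_mul b, Real.rpow_add hx]
        field_simp
end

section
/- Let b ∈ (0, 1/2]. There exists a constant C_b > 0 such that for every x > 0 and every t with 0 < t/x ≤ 6π, setting f(w) := (t/x) · w/(w − x), one has ( ∫_{{w : x/2 < w < 3x/2, w ≠ x}} |e^{i f(w)} − 1|² / |w|^{1+2b} dw )^{1/2} ≤ C_b t^b / x^{2b}. -/
open MeasureTheory

/-- A Lorentzian bound for `‖e^{iθ} - 1‖²` when `|θ| ≤ (3/2) / |v|`. -/
lemma norm_exp_I_mul_sub_one_sq_le {θ v : ℝ} (h : |θ| * |v| ≤ 3 / 2) :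
    ‖Complex.exp (Complex.I * (θ : ℂ)) - 1‖ ^ 2 ≤ 8 * (1 + v ^ 2)⁻¹ := by
  have h1 : ‖Complex.exp (Complex.I * (θ : ℂ)) - 1‖ ≤ |θ| :=
    Real.norm_exp_I_mul_ofReal_sub_one_le
  have h2 : ‖Complex.exp (Complex.I * (θ : ℂ)) - 1‖ ≤ 2 := by
    refine (norm_sub_le _ _).trans ?_
    rw [Complex.norm_exp_I_mul_ofReal, norm_one]
    norm_num
  have h0 := norm_nonneg (Complex.exp (Complex.I * (θ : ℂ)) - 1)
  generalize ‖Complex.exp (Complex.I * (θ : ℂ)) - 1‖ = n at h0 h1 h2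
  have hnv : n * |v| ≤ 3 / 2 := (mul_le_mul_of_nonneg_right h1 (abs_nonneg v)).trans h
  have hsq : (n * |v|) ^ 2 ≤ (3 / 2) ^ 2 := by gcongr
  rw [mul_pow, sq_abs] at hsq
  rw [← div_eq_mul_inv, le_div_iff₀ (by positivity)]
  nlinarith

lemma integrable_inv_one_add_sub_div_sq (x : ℝ) {t : ℝ} (ht : t ≠ 0) :
    Integrable fun w : ℝ => (1 + ((w - x) / t) ^ 2)⁻¹ :=
  (integrable_inv_one_add_sq.comp_div ht).comp_sub_right x

lemma integral_inv_one_add_sub_div_sq (x : ℝ) {t : ℝ} (ht : 0 < t) :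
    ∫ w : ℝ, (1 + ((w - x) / t) ^ 2)⁻¹ = Real.pi * t := by
  rw [integral_sub_right_eq_self (fun w : ℝ => (1 + (w / t) ^ 2)⁻¹) x,
    Measure.integral_comp_div (fun w : ℝ => (1 + w ^ 2)⁻¹) t, integral_univ_inv_one_add_sq,
    abs_of_pos ht, smul_eq_mul, mul_comm]

/-- The integral near the singularity `w = x` of the phase is linear in `t`. -/
lemma setIntegral_mobiusPhase_le {b x t : ℝ} (hb : 0 < b) (hx : 0 < x) (ht : 0 < t) :
    ∫ w in {w : ℝ | x / 2 < w ∧ w < 3 * x / 2 ∧ w ≠ x},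
        ‖Complex.exp (Complex.I * ((mobiusPhase t x w : ℝ) : ℂ)) - 1‖ ^ 2 / |w| ^ (1 + 2 * b) ≤
      8 / (x / 2) ^ (1 + 2 * b) * (Real.pi * t) := by
  set S := {w : ℝ | x / 2 < w ∧ w < 3 * x / 2 ∧ w ≠ x}
  have hS : MeasurableSet S :=
    measurableSet_Ioi.inter (measurableSet_Iio.inter (measurableSet_singleton x).compl)
  have hint := (integrable_inv_one_add_sub_div_sq x ht.ne').const_mul
    (8 / (x / 2) ^ (1 + 2 * b))
  rw [← integral_inv_one_add_sub_div_sq x ht, ← integral_const_mul]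
  refine (integral_mono_of_nonneg (ae_of_all _ fun w => by positivity) hint.integrableOn
    ((ae_restrict_iff' hS).2 (ae_of_all _ ?_))).trans
    (setIntegral_le_integral hint (ae_of_all _ fun w => by positivity))
  rintro w ⟨h1, h2, h3⟩
  have hw : 0 < w := by linarith
  have hphase : |mobiusPhase t x w| * |(w - x) / t| ≤ 3 / 2 := by
    have hwx : w - x ≠ 0 := sub_ne_zero.2 h3
    have : mobiusPhase t x w * ((w - x) / t) = w / x := by
      unfold mobiusPhase
      field_simp
    rw [← abs_mul, this, abs_of_pos (by positivity), div_le_iff₀ hx]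
    linarith
  have hexp := norm_exp_I_mul_sub_one_sq_le hphase
  calc ‖Complex.exp (Complex.I * ((mobiusPhase t x w : ℝ) : ℂ)) - 1‖ ^ 2 / |w| ^ (1 + 2 * b)
      ≤ 8 * (1 + ((w - x) / t) ^ 2)⁻¹ / (x / 2) ^ (1 + 2 * b) := by
        rw [abs_of_pos hw]
        gcongr
    _ = 8 / (x / 2) ^ (1 + 2 * b) * (1 + ((w - x) / t) ^ 2)⁻¹ := by ring

theorem mobius_phase_integral_middle (b : ℝ) (hb : b ∈ Set.Ioc (0 : ℝ) (1 / 2)) :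
    ∃ C : ℝ, 0 < C ∧ ∀ x : ℝ, 0 < x → ∀ t : ℝ, 0 < t / x → t / x ≤ 6 * Real.pi →
      (∫ w in {w : ℝ | x / 2 < w ∧ w < 3 * x / 2 ∧ w ≠ x},
          ‖Complex.exp (Complex.I * ((mobiusPhase t x w : ℝ) : ℂ)) - 1‖ ^ 2 /
            |w| ^ (1 + 2 * b)) ^ ((1 : ℝ) / 2) ≤ C * t ^ b / x ^ (2 * b) := by
  obtain ⟨hb0, hb1⟩ := hb
  have hpi := Real.pi_pos
  set K : ℝ := 8 * Real.pi * 2 ^ (1 + 2 * b) * (6 * Real.pi) ^ (1 - 2 * b) with hK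
  have hK0 : 0 < K := by positivity
  refine ⟨K ^ ((1 : ℝ) / 2), by positivity, fun x hx t htx htx' => ?_⟩
  have ht : 0 < t := (div_pos_iff_of_pos_right hx).1 htx
  have hsplit : t / x ≤ (6 * Real.pi) ^ (1 - 2 * b) * (t / x) ^ (2 * b) := by
    calc t / x = (t / x) ^ (1 - 2 * b) * (t / x) ^ (2 * b) := by
          rw [← Real.rpow_add htx, sub_add_cancel, Real.rpow_one]
      _ ≤ _ := by
          have : 0 ≤ 1 - 2 * b := by linarith
          gcongr
  have hbound : 8 / (x / 2) ^ (1 + 2 * b) * (Real.pi * t) ≤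
      K * (t ^ (2 * b) / (x ^ (2 * b) * x ^ (2 * b))) := by
    calc 8 / (x / 2) ^ (1 + 2 * b) * (Real.pi * t)
        = 8 * Real.pi * 2 ^ (1 + 2 * b) / x ^ (2 * b) * (t / x) := by
          rw [Real.div_rpow hx.le zero_le_two, Real.rpow_add hx, Real.rpow_one]
          field_simp
      _ ≤ 8 * Real.pi * 2 ^ (1 + 2 * b) / x ^ (2 * b) *
            ((6 * Real.pi) ^ (1 - 2 * b) * (t / x) ^ (2 * b)) := by gcongr
      _ = _ := by
          rw [Real.div_rpow ht.le hx.le, hK]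
          field_simp
  calc _ ≤ (K * (t ^ (2 * b) / (x ^ (2 * b) * x ^ (2 * b)))) ^ ((1 : ℝ) / 2) :=
        Real.rpow_le_rpow (integral_nonneg fun w => by positivity)
          ((setIntegral_mobiusPhase_le hb0 hx ht).trans hbound) (by norm_num)
    _ = K ^ ((1 : ℝ) / 2) * t ^ b / x ^ (2 * b) := by
        rw [Real.mul_rpow hK0.le (by positivity), Real.div_rpow (by positivity) (by positivity),
          ← Real.rpow_mul ht.le, ← Real.sqrt_eq_rpow (x ^ (2 * b) * x ^ (2 * b)),
          Real.sqrt_mul_self (by positivity), show 2 * b * (1 / 2) = b by ring, mul_div_assoc]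
end

section
/- Let b ∈ (0, 1/2]. There exists a constant C_b > 0 such that for every x > 0 and every t with t/x > 6π, setting g(w) := (t/x) · 1/(1 − xw), one has ( ∫_{(−∞, 1/x − t/(2πx²)]} |e^{i g(w)} − 1|² / |w|^{1−2b} dw )^{1/2} ≤ C_b t^b / x^{2b}. -/
open MeasureTheory

/-- The phase `g(w) = (t/x) · 1/(1 − xw)` arising, after the change of variables `w ↦ 1/w`,
in the representation of the Stein derivative of `y ↦ e^{−it/y}`. -/
noncomputable def mobiusPhase' (t x w : ℝ) : ℝ := t / x * (1 / (1 - x * w))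

theorem norm_exp_mobiusPhase'_neg_sub_one_le {t x v : ℝ} (ht : 0 < t) (hx : 0 < x) (hv : 0 < v) :
    ‖Complex.exp (Complex.I * ((mobiusPhase' t x (-v) : ℝ) : ℂ)) - 1‖ ≤ t / x ^ 2 / v := by
  refine Real.norm_exp_I_mul_ofReal_sub_one_le.trans ?_
  have hxv : 0 < x * v := mul_pos hx hv
  have h1 : 0 < 1 - x * -v := by linarith
  have hg : 0 ≤ mobiusPhase' t x (-v) := by
    unfold mobiusPhase'
    positivity
  rw [Real.norm_of_nonneg hg]
  calc mobiusPhase' t x (-v) = t / x * (1 / (1 - x * -v)) := rfl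
    _ ≤ t / x * (1 / (x * v)) := by
        gcongr
        linarith
    _ = t / x ^ 2 / v := by field_simp

theorem norm_exp_mobiusPhase'_neg_sub_one_sq_div_le {t x v : ℝ} (b : ℝ) (ht : 0 < t) (hx : 0 < x)
    (hv : 0 < v) :
    ‖Complex.exp (Complex.I * ((mobiusPhase' t x (-v) : ℝ) : ℂ)) - 1‖ ^ 2 / |-v| ^ (1 - 2 * b) ≤
      (t / x ^ 2) ^ 2 * v ^ (2 * b - 3) := by
  rw [abs_neg, abs_of_pos hv]
  calc _ ≤ (t / x ^ 2 / v) ^ 2 / v ^ (1 - 2 * b) := by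
        gcongr
        exact norm_exp_mobiusPhase'_neg_sub_one_le ht hx hv
    _ = (t / x ^ 2) ^ 2 * v ^ (2 * b - 3) := by
        rw [show 2 * b - 3 = -(2 : ℕ) - (1 - 2 * b) by push_cast; ring,
          Real.rpow_sub hv (-(2 : ℕ)), Real.rpow_neg hv.le, Real.rpow_natCast]
        ring

theorem setIntegral_Iic_neg_mobiusPhase'_le {b t x A : ℝ} (hb : b < 1) (ht : 0 < t) (hx : 0 < x)
    (hA : 0 < A) :
    ∫ w in Set.Iic (-A), ‖Complex.exp (Complex.I * ((mobiusPhase' t x w : ℝ) : ℂ)) - 1‖ ^ 2 /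
        |w| ^ (1 - 2 * b) ≤ (t / x ^ 2) ^ 2 * (A ^ (2 * b - 2) / (2 - 2 * b)) := by
  have hflip := integral_comp_neg_Ioi A fun w : ℝ ↦
    ‖Complex.exp (Complex.I * ((mobiusPhase' t x w : ℝ) : ℂ)) - 1‖ ^ 2 / |w| ^ (1 - 2 * b)
  have hexp : 2 * b - 3 < -1 := by linarith
  rw [← hflip]
  calc _ ≤ ∫ v in Set.Ioi A, (t / x ^ 2) ^ 2 * v ^ (2 * b - 3) := by
        refine integral_mono_of_nonneg (Filter.Eventually.of_forall fun v ↦ by positivity)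
          ((integrableOn_Ioi_rpow_of_lt hexp hA).const_mul _) ?_
        filter_upwards [ae_restrict_mem measurableSet_Ioi] with v hv
        exact norm_exp_mobiusPhase'_neg_sub_one_sq_div_le b ht hx (hA.trans hv)
    _ = (t / x ^ 2) ^ 2 * (A ^ (2 * b - 2) / (2 - 2 * b)) := by
        rw [integral_const_mul, integral_Ioi_rpow_of_lt hexp hA,
          show 2 * b - 3 + 1 = 2 * b - 2 by ring, neg_div, ← div_neg, neg_sub]

theorem mobius_phase'_integral_F1 (b : ℝ) (hb : b ∈ Set.Ioc (0 : ℝ) (1 / 2)) :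
    ∃ C : ℝ, 0 < C ∧ ∀ x : ℝ, 0 < x → ∀ t : ℝ, 6 * Real.pi < t / x →
      (∫ w in Set.Iic (1 / x - t / (2 * Real.pi * x ^ 2)),
          ‖Complex.exp (Complex.I * ((mobiusPhase' t x w : ℝ) : ℂ)) - 1‖ ^ 2 /
            |w| ^ (1 - 2 * b)) ^ ((1 : ℝ) / 2) ≤ C * t ^ b / x ^ (2 * b) := by
  obtain ⟨hb0, hb1⟩ := hb
  have hpi := Real.pi_pos
  have hpi3 := Real.pi_gt_three
  refine ⟨3 * Real.pi, by positivity, fun x hx t htx ↦ ?_⟩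
  have hlt : 6 * Real.pi * x < t := (lt_div_iff₀ hx).1 htx
  have ht : 0 < t := lt_trans (by positivity) hlt
  set s := t / x ^ 2 with hs
  have hs0 : 0 < s := by positivity
  have hsA : s / (3 * Real.pi) ≤ t / (2 * Real.pi * x ^ 2) - 1 / x := by
    have : t / (2 * Real.pi * x ^ 2) - 1 / x - s / (3 * Real.pi) =
        (t - 6 * Real.pi * x) / (6 * Real.pi * x ^ 2) := by
      rw [hs]
      field_simp
      ring
    have : 0 ≤ (t - 6 * Real.pi * x) / (6 * Real.pi * x ^ 2) :=
      div_nonneg (by linarith) (by positivity)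
    linarith
  have hr0 : 0 < s / (3 * Real.pi) := by positivity
  have hA : 0 < t / (2 * Real.pi * x ^ 2) - 1 / x := hr0.trans_le hsA
  rw [← neg_sub (t / (2 * Real.pi * x ^ 2)) (1 / x)]
  have hint : ∫ w in Set.Iic (-(t / (2 * Real.pi * x ^ 2) - 1 / x)),
      ‖Complex.exp (Complex.I * ((mobiusPhase' t x w : ℝ) : ℂ)) - 1‖ ^ 2 /
        |w| ^ (1 - 2 * b) ≤ (3 * Real.pi * s ^ b) ^ 2 := by
    refine (setIntegral_Iic_neg_mobiusPhase'_le (by linarith) ht hx hA).trans ?_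
    calc s ^ 2 * ((t / (2 * Real.pi * x ^ 2) - 1 / x) ^ (2 * b - 2) / (2 - 2 * b))
        ≤ s ^ 2 * (s / (3 * Real.pi)) ^ (2 * b - 2) := by
          gcongr
          refine (div_le_self (by positivity) (by linarith)).trans ?_
          exact Real.rpow_le_rpow_of_nonpos hr0 hsA (by linarith)
      _ = (s ^ b) ^ 2 * (3 * Real.pi) ^ (2 - 2 * b) := by
          rw [Real.div_rpow hs0.le (by positivity), ← neg_sub 2 (2 * b),
            Real.rpow_neg (by positivity : 0 ≤ 3 * Real.pi), div_inv_eq_mul, ← mul_assoc,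
            ← Real.rpow_natCast s 2, ← Real.rpow_add hs0, ← Real.rpow_mul_natCast hs0.le]
          congr 2
          push_cast
          ring
      _ ≤ (s ^ b) ^ 2 * (3 * Real.pi) ^ (2 : ℝ) := by
          gcongr
          · linarith
          · linarith
      _ = (3 * Real.pi * s ^ b) ^ 2 := by
          rw [Real.rpow_two]
          ring
  calc _ ≤ ((3 * Real.pi * s ^ b) ^ 2) ^ ((1 : ℝ) / 2) :=
        Real.rpow_le_rpow (integral_nonneg fun w ↦ by positivity) hint (by norm_num)
    _ = 3 * Real.pi * s ^ b := by
        rw [← Real.sqrt_eq_rpow, Real.sqrt_sq (by positivity)]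
    _ = 3 * Real.pi * t ^ b / x ^ (2 * b) := by
        rw [hs, Real.div_rpow ht.le (by positivity), Real.rpow_mul hx.le, Real.rpow_two,
          mul_div_assoc]
end

section
/- Let b ∈ (0, 1/2]. There exists a constant C_b > 0 such that for every x > 0 and every t with t/x > 6π, setting g(w) := (t/x) · 1/(1 − xw), one has ( ∫_{(1/x − t/(2πx²), 1/x)} |e^{i g(w)} − 1|² / |w|^{1−2b} dw )^{1/2} ≤ C_b t^b / x^{2b}. -/
open MeasureTheory

/-- An even power `|w| ^ r` with `-1 < r` is interval integrable on `[-L, L]`, with the expected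
integral. -/
theorem intervalIntegrable_abs_rpow_and_integral {r L : ℝ} (hr : -1 < r) (hL : 0 ≤ L) :
    IntervalIntegrable (fun w : ℝ => |w| ^ r) volume (-L) L ∧
      ∫ w in (-L)..L, |w| ^ r = 2 * (L ^ (r + 1) / (r + 1)) := by
  have hpos : Set.EqOn (fun w : ℝ => w ^ r) (fun w => |w| ^ r) (Set.uIcc 0 L) := by
    intro w hw
    rw [Set.uIcc_of_le hL] at hw
    simp only [abs_of_nonneg hw.1]
  have hright : IntervalIntegrable (fun w : ℝ => |w| ^ r) volume 0 L :=
    (intervalIntegral.intervalIntegrable_rpow' hr).congr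
      (f := fun w : ℝ => w ^ r) fun w hw => hpos (Set.uIoc_subset_uIcc hw)
  have hleft : IntervalIntegrable (fun w : ℝ => |w| ^ r) volume (-L) 0 := by
    simpa using ((IntervalIntegrable.iff_comp_neg (by simp)).1 hright).symm
  have hval : ∫ w in (0 : ℝ)..L, |w| ^ r = L ^ (r + 1) / (r + 1) := by
    rw [← intervalIntegral.integral_congr hpos, integral_rpow (Or.inl hr),
      Real.zero_rpow (by linarith), sub_zero]
  have hneg : ∫ w in (-L)..0, |w| ^ r = ∫ w in (0 : ℝ)..L, |w| ^ r := by
    simpa using (intervalIntegral.integral_comp_neg (a := 0) (b := L)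
      (fun w : ℝ => |w| ^ r)).symm
  refine ⟨hleft.trans hright, ?_⟩
  rw [← intervalIntegral.integral_add_adjacent_intervals hleft hright, hneg, hval, two_mul]

theorem mobius_phase'_integral_F2 (b : ℝ) (hb : b ∈ Set.Ioc (0 : ℝ) (1 / 2)) :
    ∃ C : ℝ, 0 < C ∧ ∀ x : ℝ, 0 < x → ∀ t : ℝ, 6 * Real.pi < t / x →
      (∫ w in Set.Ioo (1 / x - t / (2 * Real.pi * x ^ 2)) (1 / x),
          ‖Complex.exp (Complex.I * ((mobiusPhase' t x w : ℝ) : ℂ)) - 1‖ ^ 2 /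
            |w| ^ (1 - 2 * b)) ^ ((1 : ℝ) / 2) ≤ C * t ^ b / x ^ (2 * b) := by
  have hb0 : 0 < b := hb.1
  refine ⟨(4 / b) ^ ((1 : ℝ) / 2), by positivity, fun x hx t ht => ?_⟩
  have hpi := Real.pi_gt_three
  have htx : 6 * Real.pi * x < t := (lt_div_iff₀ hx).1 ht
  have ht0 : 0 < t := lt_trans (by positivity) htx
  set L := t / (2 * Real.pi * x ^ 2) with hL
  have hL0 : 0 < L := by positivity
  have hxL : 1 / x ≤ L := by
    rw [hL, div_le_div_iff₀ hx (by positivity)]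
    nlinarith [mul_pos hx hx, mul_lt_mul_of_pos_right htx hx, mul_pos Real.pi_pos (mul_pos hx hx)]
  have hLt : L ≤ t / x ^ 2 :=
    div_le_div_of_nonneg_left ht0.le (by positivity)
      (le_mul_of_one_le_left (by positivity) (by linarith))
  have hsub : Set.Ioo (1 / x - L) (1 / x) ⊆ Set.Ioc (-L) L := fun w hw =>
    ⟨by linarith [hw.1, one_div_pos.2 hx], hw.2.le.trans hxL⟩
  obtain ⟨hint, hval⟩ :=
    intervalIntegrable_abs_rpow_and_integral (r := 2 * b - 1) (by linarith) hL0.le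
  have hint4 : IntegrableOn (fun w : ℝ => 4 * |w| ^ (2 * b - 1)) (Set.Ioc (-L) L) :=
    ((intervalIntegrable_iff_integrableOn_Ioc_of_le (by linarith)).1 hint).const_mul 4
  have hbound : ∫ w in Set.Ioo (1 / x - L) (1 / x),
      ‖Complex.exp (Complex.I * ((mobiusPhase' t x w : ℝ) : ℂ)) - 1‖ ^ 2 / |w| ^ (1 - 2 * b) ≤
        4 / b * (t / x ^ 2) ^ (2 * b) := by
    calc _ ≤ ∫ w in Set.Ioo (1 / x - L) (1 / x), 4 * |w| ^ (2 * b - 1) := by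
          refine integral_mono_of_nonneg (.of_forall fun w => by positivity)
            (hint4.mono_set hsub) (.of_forall fun w => ?_)
          have hnorm : ‖Complex.exp (Complex.I * ((mobiusPhase' t x w : ℝ) : ℂ)) - 1‖ ≤ 2 := by
            refine (norm_sub_le _ _).trans ?_
            rw [Complex.norm_exp_I_mul_ofReal, norm_one]
            norm_num
          have hexp : |w| ^ (2 * b - 1) = (|w| ^ (1 - 2 * b))⁻¹ := by
            rw [← Real.rpow_neg (abs_nonneg w), neg_sub]
          simp only [hexp, div_eq_mul_inv]
          gcongr
          nlinarith [norm_nonneg (Complex.exp (Complex.I * ((mobiusPhase' t x w : ℝ) : ℂ)) - 1)]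
      _ ≤ ∫ w in Set.Ioc (-L) L, 4 * |w| ^ (2 * b - 1) :=
          setIntegral_mono_set hint4 (.of_forall fun w => by positivity) hsub.eventuallyLE
      _ = 4 / b * L ^ (2 * b) := by
          rw [integral_const_mul, ← intervalIntegral.integral_of_le (by linarith), hval,
            sub_add_cancel]
          field_simp
      _ ≤ 4 / b * (t / x ^ 2) ^ (2 * b) := by gcongr
  calc _ ≤ (4 / b * (t / x ^ 2) ^ (2 * b)) ^ ((1 : ℝ) / 2) :=
        Real.rpow_le_rpow (integral_nonneg fun w => by positivity) hbound (by norm_num)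
    _ = (4 / b) ^ ((1 : ℝ) / 2) * t ^ b / x ^ (2 * b) := by
        rw [Real.mul_rpow (by positivity) (by positivity), ← Real.rpow_mul (by positivity),
          show 2 * b * ((1 : ℝ) / 2) = b by ring, Real.div_rpow ht0.le (by positivity),
          ← Real.rpow_natCast x 2, ← Real.rpow_mul hx.le, mul_div_assoc]
        norm_num
end

section
/- Let b ∈ (0, 1/2]. There exists a constant C_b > 0 such that for every x > 0 and every t with t/x > 6π, setting g(w) := (t/x) · 1/(1 − xw), both ( ∫_{(1/x, 1/x + t/(2πx²)]} |e^{i g(w)} − 1|² / |w|^{1−2b} dw )^{1/2} ≤ C_b t^b / x^{2b} and ( ∫_{(1/x + t/(2πx²), ∞)} |e^{i g(w)} − 1|² / |w|^{1−2b} dw )^{1/2} ≤ C_b t^b / x^{2b} hold. -/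
open MeasureTheory

theorem norm_exp_I_mul_sub_one_sq_le_four (y : ℝ) :
    ‖Complex.exp (Complex.I * (y : ℂ)) - 1‖ ^ 2 ≤ 4 := by
  have h : ‖Complex.exp (Complex.I * (y : ℂ)) - 1‖ ≤ 2 := by
    refine (norm_sub_le _ _).trans ?_
    rw [Complex.norm_exp_I_mul_ofReal, norm_one]
    norm_num
  nlinarith [norm_nonneg (Complex.exp (Complex.I * (y : ℂ)) - 1)]

/-- On a bounded interval of positive reals the weighted integral of a function bounded by `4`
is controlled by the right endpoint. -/
theorem setIntegral_Ioc_div_rpow_le {b A B : ℝ} (hb : 0 < b) (hA : 0 < A) (hAB : A ≤ B)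
    {f : ℝ → ℝ} (hf0 : ∀ w, 0 ≤ f w) (hf : ∀ w, f w ≤ 4) :
    ∫ w in Set.Ioc A B, f w / |w| ^ (1 - 2 * b) ≤ 2 / b * B ^ (2 * b) := by
  have hint : IntervalIntegrable (fun w : ℝ => w ^ (2 * b - 1)) volume A B :=
    intervalIntegral.intervalIntegrable_rpow' (by linarith)
  calc ∫ w in Set.Ioc A B, f w / |w| ^ (1 - 2 * b)
      ≤ ∫ w in Set.Ioc A B, 4 * w ^ (2 * b - 1) := by
        refine integral_mono_of_nonneg (ae_of_all _ fun w => ?_)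
          (((intervalIntegrable_iff_integrableOn_Ioc_of_le hAB).1 hint).const_mul 4)
          ((ae_restrict_iff' measurableSet_Ioc).2 (ae_of_all _ fun w hw => ?_))
        · exact div_nonneg (hf0 w) (by positivity)
        · have hw0 : 0 < w := hA.trans hw.1
          change f w / |w| ^ (1 - 2 * b) ≤ 4 * w ^ (2 * b - 1)
          rw [abs_of_pos hw0, div_eq_mul_inv, ← Real.rpow_neg hw0.le, neg_sub]
          exact mul_le_mul_of_nonneg_right (hf w) (by positivity)
    _ = 4 * ((B ^ (2 * b) - A ^ (2 * b)) / (2 * b)) := by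
        rw [integral_const_mul, ← intervalIntegral.integral_of_le hAB,
          integral_rpow (Or.inl (by linarith)), sub_add_cancel]
    _ = 2 / b * (B ^ (2 * b) - A ^ (2 * b)) := by
        field_simp
        norm_num
    _ ≤ 2 / b * B ^ (2 * b) := by
        gcongr
        linarith [Real.rpow_nonneg hA.le (2 * b)]

/-- A function decaying like `2 K² / w²` beyond `B` has weighted tail integral controlled by the
corresponding power of `B`. -/
theorem setIntegral_Ioi_div_rpow_le {b B K : ℝ} (hb : b ≤ 1 / 2) (hB : 0 < B)
    {f : ℝ → ℝ} (hf0 : ∀ w, 0 ≤ f w) (hf : ∀ w, B < w → f w ≤ 2 * K ^ 2 / w ^ 2) :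
    ∫ w in Set.Ioi B, f w / |w| ^ (1 - 2 * b) ≤ 2 * K ^ 2 * B ^ (2 * b - 2) := by
  calc ∫ w in Set.Ioi B, f w / |w| ^ (1 - 2 * b)
      ≤ ∫ w in Set.Ioi B, 2 * K ^ 2 * w ^ (2 * b - 3) := by
        refine integral_mono_of_nonneg (ae_of_all _ fun w => ?_)
          ((integrableOn_Ioi_rpow_of_lt (by linarith) hB).const_mul _)
          ((ae_restrict_iff' measurableSet_Ioi).2 (ae_of_all _ fun w hw => ?_))
        · exact div_nonneg (hf0 w) (by positivity)
        · have hw0 : 0 < w := hB.trans hw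
          change f w / |w| ^ (1 - 2 * b) ≤ 2 * K ^ 2 * w ^ (2 * b - 3)
          have hpow : w ^ (2 * b - 3) = (w ^ 2)⁻¹ * w ^ (2 * b - 1) := by
            rw [← Real.rpow_natCast, ← Real.rpow_neg hw0.le, ← Real.rpow_add hw0]
            congr 1
            push_cast
            ring
          rw [abs_of_pos hw0, div_eq_mul_inv, ← Real.rpow_neg hw0.le, neg_sub, hpow, ← mul_assoc,
            ← div_eq_mul_inv]
          exact mul_le_mul_of_nonneg_right (hf w hw) (by positivity)
    _ = 2 * K ^ 2 * (B ^ (2 * b - 2) / (2 - 2 * b)) := by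
        rw [integral_const_mul, integral_Ioi_rpow_of_lt (by linarith) hB,
          show 2 * b - 3 + 1 = -(2 - 2 * b) by ring, neg_div_neg_eq, neg_sub]
    _ ≤ 2 * K ^ 2 * B ^ (2 * b - 2) := by
        gcongr
        exact div_le_self (by positivity) (by linarith)

theorem norm_exp_mobiusPhase'_sub_one_sq_le {t x w : ℝ} (hx : 0 < x) (hw : 4 / x < w) :
    ‖Complex.exp (Complex.I * ((mobiusPhase' t x w : ℝ) : ℂ)) - 1‖ ^ 2 ≤
      2 * (t / x ^ 2) ^ 2 / w ^ 2 := by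
  have hw0 : 0 < w := lt_trans (by positivity) hw
  have hxw : 4 < x * w := by
    rw [div_lt_iff₀ hx] at hw
    linarith
  have hphase : (mobiusPhase' t x w) ^ 2 = (t / x ^ 2) ^ 2 * (x ^ 2 / (x * w - 1) ^ 2) := by
    have h1 : 1 - x * w ≠ 0 := by linarith
    have h2 : x * w - 1 ≠ 0 := by linarith
    rw [mobiusPhase', show x * w - 1 = -(1 - x * w) by ring, neg_sq]
    field_simp
  have hratio : x ^ 2 / (x * w - 1) ^ 2 ≤ 2 / w ^ 2 := by
    rw [div_le_div_iff₀ (pow_pos (by linarith) 2) (by positivity)]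
    nlinarith
  calc ‖Complex.exp (Complex.I * ((mobiusPhase' t x w : ℝ) : ℂ)) - 1‖ ^ 2
      ≤ ‖mobiusPhase' t x w‖ ^ 2 := by
        gcongr
        exact Real.norm_exp_I_mul_ofReal_sub_one_le
    _ = (t / x ^ 2) ^ 2 * (x ^ 2 / (x * w - 1) ^ 2) := by
        rw [Real.norm_eq_abs, sq_abs, hphase]
    _ ≤ (t / x ^ 2) ^ 2 * (2 / w ^ 2) := by gcongr
    _ = 2 * (t / x ^ 2) ^ 2 / w ^ 2 := by ring

theorem sqrt_le_mul_rpow_div_rpow {b C J t x : ℝ} (hC : 1 ≤ C) (ht : 0 < t)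
    (hx : 0 < x) (h : J ≤ C * (t / x ^ 2) ^ (2 * b)) :
    J ^ ((1 : ℝ) / 2) ≤ C * t ^ b / x ^ (2 * b) := by
  have hsq : C * (t / x ^ 2) ^ (2 * b) ≤ (C * t ^ b / x ^ (2 * b)) ^ 2 := by
    have h1 : (t / x ^ 2) ^ (2 * b) = (t ^ b / x ^ (2 * b)) ^ 2 := by
      rw [Real.rpow_mul hx.le, Real.rpow_two, ← Real.div_rpow ht.le (by positivity), mul_comm 2 b,
        Real.rpow_mul (by positivity), Real.rpow_two]
    rw [h1, mul_div_assoc, mul_pow]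
    gcongr
    nlinarith
  rw [← Real.sqrt_eq_rpow]
  exact Real.sqrt_le_iff.2 ⟨by positivity, h.trans hsq⟩

theorem mobius_phase'_integral_F3_F4 (b : ℝ) (hb : b ∈ Set.Ioc (0 : ℝ) (1 / 2)) :
    ∃ C : ℝ, 0 < C ∧ ∀ x : ℝ, 0 < x → ∀ t : ℝ, 6 * Real.pi < t / x →
      ((∫ w in Set.Ioc (1 / x) (1 / x + t / (2 * Real.pi * x ^ 2)),
          ‖Complex.exp (Complex.I * ((mobiusPhase' t x w : ℝ) : ℂ)) - 1‖ ^ 2 /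
            |w| ^ (1 - 2 * b)) ^ ((1 : ℝ) / 2) ≤ C * t ^ b / x ^ (2 * b) ∧
        (∫ w in Set.Ioi (1 / x + t / (2 * Real.pi * x ^ 2)),
          ‖Complex.exp (Complex.I * ((mobiusPhase' t x w : ℝ) : ℂ)) - 1‖ ^ 2 /
            |w| ^ (1 - 2 * b)) ^ ((1 : ℝ) / 2) ≤ C * t ^ b / x ^ (2 * b)) := by
  obtain ⟨hb0, hb1⟩ := hb
  have hpi := Real.pi_gt_three
  refine ⟨2 / b + 8 * Real.pi ^ 2, by positivity, fun x hx t htx => ?_⟩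
  have hC : 1 ≤ 2 / b + 8 * Real.pi ^ 2 := by
    have : 0 < 2 / b := by positivity
    nlinarith
  have ht : 0 < t := (div_pos_iff_of_pos_right hx).1 (lt_trans (by positivity) htx)
  have hK : 0 < t / x ^ 2 := by positivity
  have hK' : t / (2 * Real.pi * x ^ 2) = t / x ^ 2 / (2 * Real.pi) := by
    field_simp
  have hxK : 3 / x < t / x ^ 2 / (2 * Real.pi) := by
    rw [lt_div_iff₀ (by positivity), pow_two, ← div_div, div_mul_eq_mul_div]
    gcongr
    linarith
  rw [hK']
  set K := t / x ^ 2
  have hx1 : 0 < 1 / x := by positivity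
  have hc : 0 < K / (2 * Real.pi) := by positivity
  have h3 : 3 / x = 3 * (1 / x) := by ring
  have hBK : 1 / x + K / (2 * Real.pi) ≤ K := by
    have : K / (2 * Real.pi) ≤ K / 2 := by
      gcongr
      linarith
    linarith
  constructor
  · refine sqrt_le_mul_rpow_div_rpow hC ht hx ?_
    refine (setIntegral_Ioc_div_rpow_le hb0 hx1 (by linarith) (fun w => by positivity)
      fun w => norm_exp_I_mul_sub_one_sq_le_four _).trans ?_
    gcongr
    exact le_add_of_nonneg_right (by positivity)
  · refine sqrt_le_mul_rpow_div_rpow hC ht hx ?_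
    refine (setIntegral_Ioi_div_rpow_le hb1 (by positivity) (fun w => by positivity)
      fun w hw => norm_exp_mobiusPhase'_sub_one_sq_le hx ?_).trans ?_
    · exact lt_trans (by rw [show 4 / x = 1 / x + 3 / x by ring]; linarith) hw
    · have hB : (1 / x + K / (2 * Real.pi)) ^ (2 * b - 2) ≤ (K / (2 * Real.pi)) ^ (2 * b - 2) :=
        Real.rpow_le_rpow_of_nonpos hc (by linarith) (by linarith)
      have hpow : (K / (2 * Real.pi)) ^ (2 * b - 2) ≤ 4 * Real.pi ^ 2 * (K ^ (2 * b) / K ^ 2) := by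
        rw [Real.rpow_sub hc, Real.rpow_two, Real.div_rpow hK.le (by positivity)]
        have h1 : 1 ≤ (2 * Real.pi) ^ (2 * b) := Real.one_le_rpow (by linarith) (by linarith)
        calc K ^ (2 * b) / (2 * Real.pi) ^ (2 * b) / (K / (2 * Real.pi)) ^ 2
            ≤ K ^ (2 * b) / (K / (2 * Real.pi)) ^ 2 := by
              gcongr
              exact div_le_self (by positivity) h1
          _ = 4 * Real.pi ^ 2 * (K ^ (2 * b) / K ^ 2) := by
              field_simp
              norm_num
      calc 2 * K ^ 2 * (1 / x + K / (2 * Real.pi)) ^ (2 * b - 2)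
          ≤ 2 * K ^ 2 * (4 * Real.pi ^ 2 * (K ^ (2 * b) / K ^ 2)) := by
            gcongr
            exact hB.trans hpow
        _ = 8 * Real.pi ^ 2 * K ^ (2 * b) := by
            field_simp
            norm_num
        _ ≤ (2 / b + 8 * Real.pi ^ 2) * K ^ (2 * b) := by
            gcongr
            exact le_add_of_nonneg_left (by positivity)
end
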